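/- Power-law-type model: assume F is a continuous cumulative distribution function with F(t) < 1 for all t, there exists v₀ > 0 with F(v₀) − F(0) > 0, and there is a function λ, eventually increasing with λ(t) → ∞, such that for every v > 0, log(F(t+v) − F(t)) ∼ −λ(t) as t → ∞. Let 1/2 < β < 1, ε_n ∈ (0,1/2] with n^β ε_n → 1, and μ_n → ∞ with λ(μ_n)/(r log n) → 1 for a fixed r > 2β − 1. Then for every level α ∈ (0,1), the power of the oracle scan test tends to 1: sup_{s≤t} P(Binomial(n, q_{s,t}(μ_n)) ≥ c_{s,t}) → 1. -/

import Mathlib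

open Filter

/-- Upper tail of the binomial distribution: `P(Binomial(n,p) ≥ c)`. -/
noncomputable def binomTail (n : ℕ) (p : ℝ) (c : ℕ) : ℝ :=
  ∑ k ∈ Finset.Icc c n, (n.choose k : ℝ) * p ^ k * (1 - p) ^ (n - k)

/-- Level-`α` critical value: the smallest `c : ℕ` with `P(Binomial(n,p) ≥ c) ≤ α`. -/
noncomputable def critVal (n : ℕ) (p α : ℝ) : ℕ :=
  sInf {c : ℕ | binomTail n p c ≤ α}


lemma bt_sum (n : ℕ) (p : ℝ) :
    ∑ k ∈ Finset.range (n+1), (n.choose k : ℝ) * p ^ k * (1 - p) ^ (n - k) = 1 := by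
  have h := congrArg (Polynomial.eval p) (bernsteinPolynomial.sum ℝ n)
  simpa [bernsteinPolynomial, Polynomial.eval_finsetSum] using h

lemma bt_var (n : ℕ) (p : ℝ) :
    ∑ k ∈ Finset.range (n+1), (n * p - k)^2 * ((n.choose k : ℝ) * p ^ k * (1 - p) ^ (n - k))
      = n * p * (1 - p) := by
  have h := congrArg (Polynomial.eval p) (bernsteinPolynomial.variance ℝ n)
  simpa [bernsteinPolynomial, Polynomial.eval_finsetSum] using h

lemma bt_cheb (n : ℕ) (p a : ℝ) (hp0 : 0 ≤ p) (hp1 : p ≤ 1) (ha : 0 < a)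
    (S : Finset ℕ) (hS : S ⊆ Finset.range (n+1)) (h : ∀ k ∈ S, a ^ 2 ≤ (n * p - k)^2) :
    ∑ k ∈ S, (n.choose k : ℝ) * p ^ k * (1 - p) ^ (n - k) ≤ n * p / a ^ 2 := by
  have hq : 0 ≤ 1 - p := by linarith
  rw [le_div_iff₀ (by positivity), Finset.sum_mul]
  calc _ ≤ ∑ k ∈ S, (n * p - k)^2 * ((n.choose k : ℝ) * p ^ k * (1 - p) ^ (n - k)) := by
        apply Finset.sum_le_sum
        intro k hk
        rw [mul_comm]
        exact mul_le_mul_of_nonneg_right (h k hk) (by positivity)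
    _ ≤ _ := Finset.sum_le_sum_of_subset_of_nonneg hS (fun k _ _ => by positivity)
    _ = _ := bt_var n p
    _ ≤ _ := by
        have : 0 ≤ n * p := by positivity
        nlinarith

lemma Icc_sub (n c : ℕ) : Finset.Icc c n ⊆ Finset.range (n+1) := by
  intro k; simp only [Finset.mem_Icc, Finset.mem_range]; omega

lemma bt_upper (n c : ℕ) (p a : ℝ) (hp0 : 0 ≤ p) (hp1 : p ≤ 1) (ha : 0 < a)
    (hc : n * p + a ≤ c) : binomTail n p c ≤ n * p / a ^ 2 := by
  refine bt_cheb n p a hp0 hp1 ha _ (Icc_sub n c) ?_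
  intro k hk
  have : (c:ℝ) ≤ k := by exact_mod_cast (Finset.mem_Icc.mp hk).1
  nlinarith

lemma bt_le_one (n c : ℕ) (p : ℝ) (hp0 : 0 ≤ p) (hp1 : p ≤ 1) : binomTail n p c ≤ 1 := by
  have hq : 0 ≤ 1 - p := by linarith
  rw [← bt_sum n p]
  exact Finset.sum_le_sum_of_subset_of_nonneg (Icc_sub n c) (fun k _ _ => by positivity)

lemma bt_lower (n c : ℕ) (p a : ℝ) (hp0 : 0 ≤ p) (hp1 : p ≤ 1) (ha : 0 < a)
    (hc : c ≤ n * p - a) : 1 - n * p / a ^ 2 ≤ binomTail n p c := by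
  have h1 := Finset.sum_sdiff (f := fun k => (n.choose k : ℝ) * p ^ k * (1 - p) ^ (n - k))
    (Icc_sub n c)
  rw [bt_sum] at h1
  have h2 := bt_cheb n p a hp0 hp1 ha (Finset.range (n+1) \ Finset.Icc c n)
    Finset.sdiff_subset (by
      intro k hk
      simp only [Finset.mem_sdiff, Finset.mem_range, Finset.mem_Icc] at hk
      have : k ≤ c := by omega
      have : (k:ℝ) ≤ c := by exact_mod_cast this
      nlinarith)
  unfold binomTail
  linarith

lemma power_bound (n : ℕ) (p q D α : ℝ) (hp0 : 0 ≤ p) (hp1 : p ≤ 1) (hq0 : 0 ≤ q) (hq1 : q ≤ 1)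
    (hD : n * q - n * p = D) (hD4 : 4 ≤ D) (hα : n * p / (D/4)^2 ≤ α) :
    1 - 4 * (n * p / D^2 + 1 / D) ≤ binomTail n q (critVal n p α) := by
  have hc : critVal n p α ≤ ⌈n * p + D/4⌉₊ := by
    apply Nat.sInf_le
    exact (bt_upper n _ p (D/4) hp0 hp1 (by linarith) (Nat.le_ceil _)).trans hα
  have hc' : (critVal n p α : ℝ) ≤ n * q - D/2 := by
    have h1 : (critVal n p α : ℝ) ≤ (⌈n * p + D/4⌉₊ : ℝ) := by exact_mod_cast hc
    have h2 := Nat.ceil_lt_add_one (a := n * p + D/4) (by positivity)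
    linarith
  have := bt_lower n _ q (D/2) hq0 hq1 (by linarith) hc'
  have e : 1 - n * q / (D/2)^2 = 1 - 4 * (n * p / D^2 + 1 / D) := by
    have : n * q = n * p + D := by linarith
    have : D ≠ 0 := by linarith
    rw [‹n * q = _›]; field_simp; norm_num
  linarith

/-- In power-law-type models with `log(F(t+v) - F(t)) ∼ -λ(t)`, above the detection
boundary `r = 2β - 1` the oracle scan test is asymptotically powerful. -/
theorem oracle_scan_achieves_power_law_boundary
    (F : ℝ → ℝ) (hFcont : Continuous F) (hFmono : Monotone F)
    (hFbot : Tendsto F atBot (nhds 0)) (hFtop : Tendsto F atTop (nhds 1))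
    (hFlt1 : ∀ t, F t < 1)
    (v₀ : ℝ) (hv₀ : 0 < v₀) (hFv₀ : 0 < F v₀ - F 0)
    (lam : ℝ → ℝ) (t₀ : ℝ)
    (hlammono : MonotoneOn lam (Set.Ici t₀))
    (hlamtop : Tendsto lam atTop atTop)
    (hreg : ∀ v : ℝ, 0 < v →
      Tendsto (fun t => Real.log (F (t + v) - F t) / (-lam t)) atTop (nhds 1))
    (β r : ℝ) (hβ : β ∈ Set.Ioo (1 / 2 : ℝ) 1) (hr : 2 * β - 1 < r)
    (ε : ℕ → ℝ) (hε : ∀ n, ε n ∈ Set.Ioc (0 : ℝ) (1 / 2))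
    (hεβ : Tendsto (fun n : ℕ => (n : ℝ) ^ β * ε n) atTop (nhds 1))
    (μ : ℕ → ℝ) (hμ : ∀ n, 0 ≤ μ n) (hμtop : Tendsto μ atTop atTop)
    (hμr : Tendsto (fun n : ℕ => lam (μ n) / (r * Real.log n)) atTop (nhds 1))
    (α : ℝ) (hα : α ∈ Set.Ioo (0 : ℝ) 1) :
    Tendsto (fun n : ℕ =>
        sSup {x : ℝ | ∃ s t : ℝ, s ≤ t ∧
          x = binomTail n ((1 - ε n) * (F t - F s) + ε n * (F (t - μ n) - F (s - μ n)))
                (critVal n (F t - F s) α)})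
      atTop (nhds 1) := by
  obtain ⟨hβ1, hβ2⟩ := hβ
  obtain ⟨hα0, hα1⟩ := hα
  have F0 : ∀ x, 0 ≤ F x := fun x => hFmono.le_of_tendsto hFbot x
  have F1 : ∀ x, F x ≤ 1 := fun x => (hFlt1 x).le
  set Q : ℝ := F v₀ - F 0 with hQ
  set r' : ℝ := (2 * β - 1 + r) / 2 with hr'
  have hr'r : r' < r := by rw [hr']; linarith
  have hr'0 : 0 < r' := by rw [hr']; linarith
  have hr0 : 0 < r := by linarith
  set p : ℕ → ℝ := fun n => F (μ n + v₀) - F (μ n) with hp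
  have hp0 : ∀ n, 0 ≤ p n := fun n => sub_nonneg.2 (hFmono (by linarith))
  have hp1 : ∀ n, p n ≤ 1 := fun n => by
    have := F0 (μ n); have := F1 (μ n + v₀); simp only [hp]; linarith
  have hQ1 : Q ≤ 1 := by
    have := F0 0; have := F1 v₀; rw [hQ]; linarith
  set D : ℕ → ℝ := fun n => n * (ε n * (Q - p n)) with hDdef
  have hlog : Tendsto (fun n : ℕ => Real.log n) atTop atTop :=
    Real.tendsto_log_atTop.comp tendsto_natCast_atTop_atTop
  have hmul := ((hreg v₀ hv₀).comp hμtop).mul hμr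
  -- upper bound on p
  have hpup : ∀ᶠ n : ℕ in atTop, p n ≤ (n:ℝ) ^ (-r') := by
    have hlt : r' / r < 1 * 1 := by rw [one_mul, div_lt_one hr0]; exact hr'r
    filter_upwards [hmul.eventually (lt_mem_nhds hlt), hlog.eventually_gt_atTop 0,
      (hlamtop.comp hμtop).eventually_gt_atTop 0, eventually_gt_atTop 0] with n h1 h2 h3 h4
    simp only [Function.comp] at h1 h3
    have hn : (0:ℝ) < n := by exact_mod_cast h4
    rcases (hp0 n).eq_or_lt with h | h
    · rw [← h]; positivity
    have e : Real.log (F (μ n + v₀) - F (μ n)) / -lam (μ n) * (lam (μ n) / (r * Real.log n))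
        = - Real.log (p n) / (r * Real.log n) := by
      simp only [hp]; field_simp
    rw [e, div_lt_div_iff₀ hr0 (by positivity)] at h1
    have h5 : Real.log (p n) ≤ Real.log n * (-r') := by
      have : r * (r' * Real.log n) < r * (- Real.log (p n)) := by linarith
      have := lt_of_mul_lt_mul_left this hr0.le
      linarith
    rw [Real.rpow_def_of_pos hn]
    exact (Real.log_le_iff_le_exp h).1 h5
  have hnat : Tendsto (fun n : ℕ => (n:ℝ)) atTop atTop := tendsto_natCast_atTop_atTop
  have hsmall : Tendsto (fun n : ℕ => (n:ℝ) ^ (-r')) atTop (nhds 0) :=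
    (tendsto_rpow_neg_atTop hr'0).comp hnat
  have hDlow : ∀ᶠ n : ℕ in atTop, Q / 4 * (n:ℝ) ^ (1 - β) ≤ D n := by
    filter_upwards [hpup, hsmall.eventually (gt_mem_nhds (show (0:ℝ) < Q / 2 by linarith)),
      hεβ.eventually (lt_mem_nhds (show (1/2:ℝ) < 1 by norm_num)), eventually_gt_atTop 0]
      with n h1 h2 h3 h4
    have hn : (0:ℝ) < n := by exact_mod_cast h4
    have e : (n:ℝ) = (n:ℝ) ^ (1 - β) * (n:ℝ) ^ β := by
      rw [← Real.rpow_add hn]; simp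
    have e2 : D n = (n:ℝ) ^ (1 - β) * (((n:ℝ) ^ β * ε n) * (Q - p n)) := by
      simp only [hDdef]
      conv_lhs => rw [e]
      ring
    rw [e2, mul_comm (Q/4)]
    apply mul_le_mul_of_nonneg_left _ (by positivity)
    have h5 : Q / 2 ≤ Q - p n := by linarith
    calc Q / 4 = 1/2 * (Q/2) := by ring
      _ ≤ _ := mul_le_mul h3.le h5 (by linarith) (by linarith)
  have hpow : Tendsto (fun n : ℕ => (n:ℝ) ^ (1 - β)) atTop atTop :=
    (tendsto_rpow_atTop (by linarith)).comp hnat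
  have hDtop : Tendsto D atTop atTop :=
    tendsto_atTop_mono' _ hDlow (hpow.const_mul_atTop (by linarith))
  have hvar : Tendsto (fun n : ℕ => n * p n / (D n)^2) atTop (nhds 0) := by
    have hg : Tendsto (fun n : ℕ => (16 / Q^2) * (n:ℝ) ^ (-(r' + 1 - 2 * β))) atTop (nhds 0) := by
      have : 0 < r' + 1 - 2 * β := by rw [hr']; linarith
      simpa using ((tendsto_rpow_neg_atTop this).comp hnat).const_mul (16 / Q^2)
    refine squeeze_zero' (Eventually.of_forall fun n => ?_) ?_ hg
    · have := hp0 n; positivity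
    filter_upwards [hpup, hDlow, eventually_gt_atTop 0] with n h1 h2 h4
    have hn : (0:ℝ) < n := by exact_mod_cast h4
    have hx : (0:ℝ) < (n:ℝ) ^ (1 - β) := by positivity
    calc n * p n / (D n)^2 ≤ n * (n:ℝ) ^ (-r') / (Q / 4 * (n:ℝ) ^ (1 - β))^2 := by
          gcongr
      _ = (16 / Q^2) * (n:ℝ) ^ (-(r' + 1 - 2 * β)) := by
          have e : n * (n:ℝ) ^ (-r') = (n:ℝ) ^ (-(r' + 1 - 2 * β)) * ((n:ℝ) ^ (1 - β))^2 := by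
            rw [← Real.rpow_natCast ((n:ℝ) ^ (1 - β)), ← Real.rpow_mul hn.le,
              ← Real.rpow_add hn]
            nth_rewrite 1 [← Real.rpow_one (n:ℝ)]
            rw [← Real.rpow_add hn]
            congr 1
            push_cast
            ring
          rw [e]
          field_simp
          norm_num
  have hlow : Tendsto (fun n : ℕ => 1 - 4 * (n * p n / (D n)^2 + 1 / D n)) atTop (nhds 1) := by
    have h1 : Tendsto (fun n => 1 / D n) atTop (nhds 0) := by
      simp only [one_div]
      exact hDtop.inv_tendsto_atTop
    simpa using ((hvar.add h1).const_mul 4).const_sub 1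
  -- boundedness
  have hqb : ∀ n s t, s ≤ t →
      0 ≤ (1 - ε n) * (F t - F s) + ε n * (F (t - μ n) - F (s - μ n)) ∧
      (1 - ε n) * (F t - F s) + ε n * (F (t - μ n) - F (s - μ n)) ≤ 1 := by
    intro n s t hst
    obtain ⟨he1, he2⟩ := hε n
    have a1 : 0 ≤ F t - F s := sub_nonneg.2 (hFmono hst)
    have a2 : 0 ≤ F (t - μ n) - F (s - μ n) := sub_nonneg.2 (hFmono (by linarith))
    have a3 : F t - F s ≤ 1 := by linarith [F1 t, F0 s]
    have a4 : F (t - μ n) - F (s - μ n) ≤ 1 := by linarith [F1 (t - μ n), F0 (s - μ n)]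
    constructor
    · have : 0 ≤ 1 - ε n := by linarith
      positivity
    · nlinarith
  refine tendsto_of_tendsto_of_tendsto_of_le_of_le' hlow tendsto_const_nhds ?_ ?_
  · have hv2 : ∀ᶠ n : ℕ in atTop, n * p n / (D n)^2 < α / 16 :=
      hvar.eventually (gt_mem_nhds (by linarith))
    filter_upwards [hv2, hDtop.eventually_ge_atTop 4] with n h1 h2
    have hb : BddAbove {x : ℝ | ∃ s t : ℝ, s ≤ t ∧
          x = binomTail n ((1 - ε n) * (F t - F s) + ε n * (F (t - μ n) - F (s - μ n)))
                (critVal n (F t - F s) α)} := by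
      refine ⟨1, ?_⟩
      rintro x ⟨s, t, hst, rfl⟩
      exact bt_le_one _ _ _ (hqb n s t hst).1 (hqb n s t hst).2
    refine le_trans ?_ (le_csSup hb ⟨μ n, μ n + v₀, by linarith, rfl⟩)
    have hq := hqb n (μ n) (μ n + v₀) (by linarith)
    refine power_bound n (p n) _ (D n) α (hp0 n) (hp1 n) hq.1 hq.2 ?_ h2 ?_
    · have e1 : μ n + v₀ - μ n = v₀ := by ring
      simp only [hDdef, hp, hQ, e1, sub_self]
      ring
    · have : n * p n / (D n / 4)^2 = 16 * (n * p n / (D n)^2) := by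
        field_simp
        try norm_num
      linarith
  · refine Eventually.of_forall fun n => ?_
    refine csSup_le ⟨_, 0, 0, le_rfl, rfl⟩ ?_
    rintro x ⟨s, t, hst, rfl⟩
    exact bt_le_one _ _ _ (hqb n s t hst).1 (hqb n s t hst).2
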